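/- In ℤ⟦X⟧, the generating function C^{(1)} := Σ_{m≥0} C_m^{(1)} X^m of the torus coefficients satisfies (1 − 4X)^2 · C^{(1)} = 2X^2 · C^{(0)}, where C^{(0)} := Σ_{m≥0} C_m^{(0)} X^m is the Catalan generating function; equivalently C^{(1)}(x) = 2x^2·C^{(0)}(x)/(1 − 4x)^2. -/

import Mathlib

open PowerSeries Finset

/-- The Catalan generating function over `ℤ` satisfies `C = 1 + X * C ^ 2`. -/
lemma mk_catalan_eq_one_add :
    (PowerSeries.mk fun m => (catalan m : ℤ)) =
      1 + X * (PowerSeries.mk fun m => (catalan m : ℤ)) ^ 2 := by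
  have h := congrArg (PowerSeries.map (Nat.castRingHom ℤ)) catalanSeries_sq_mul_X_add_one
  have hc : PowerSeries.map (Nat.castRingHom ℤ) catalanSeries =
      PowerSeries.mk fun m => (catalan m : ℤ) := by
    ext n
    simp
  simp only [map_add, map_mul, map_pow, map_one, PowerSeries.map_X, hc] at h
  linear_combination -h

/-- The series with coefficients `k * (k + 1) * a k` is `X` times the second derivative of `X` times
the series with coefficients `a k`. -/
lemma mk_mul_succ_eq_X_mul_derivative {R : Type*} [CommRing R] (a : ℕ → R) :
    (PowerSeries.mk fun k => (k : R) * ((k : R) + 1) * a k) =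
      X * d⁄dX R (d⁄dX R (X * PowerSeries.mk a)) := by
  ext n
  cases n with
  | zero => simp
  | succ n =>
    rw [coeff_succ_X_mul, coeff_derivative, coeff_derivative, coeff_succ_X_mul, coeff_mk, coeff_mk]
    push_cast
    ring

/-- If `F = X + F ^ 2`, then `(1 - 2 * F) ^ 3` times the second derivative of `F` is `2`. -/
lemma cube_mul_derivative_derivative {R : Type*} [CommRing R] {F : R⟦X⟧} (hF : F = X + F ^ 2) :
    (1 - 2 * F) ^ 3 * d⁄dX R (d⁄dX R F) = 2 := by
  have h1 : d⁄dX R F = 1 + 2 * (F * d⁄dX R F) := by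
    conv_lhs => rw [hF]
    rw [sq, map_add, derivative_X, Derivation.leibniz, smul_eq_mul]
    ring
  have h2 : d⁄dX R (d⁄dX R F) = 2 * (F * d⁄dX R (d⁄dX R F) + d⁄dX R F ^ 2) := by
    conv_lhs => rw [h1]
    rw [two_mul, map_add, map_add, derivative_one, Derivation.leibniz, smul_eq_mul, smul_eq_mul]
    ring
  linear_combination (1 - 2 * F) ^ 2 * h2 + 2 * ((1 - 2 * F) * d⁄dX R F + 1) * h1

/-- The generating function of the torus coefficients satisfies
`(1 - 4X)² · C⁽¹⁾ = 2X² · C⁽⁰⁾` in `ℤ⟦X⟧`, where `C⁽⁰⁾` is the Catalan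
generating function. -/
theorem torus_generating_function (C1 : ℕ → ℤ)
    (h0 : C1 0 = 0)
    (hrec : ∀ m : ℕ, C1 (m + 1) =
        2 * ∑ k ∈ Finset.range (m + 1), (catalan (m - k) : ℤ) * C1 k
          + ∑ k ∈ Finset.range (m + 1),
              (k : ℤ) * ((k : ℤ) + 1) * (catalan (m - k) : ℤ) * (catalan k : ℤ)) :
    (1 - 4 * PowerSeries.X) ^ 2 * PowerSeries.mk C1 =
      2 * PowerSeries.X ^ 2 * PowerSeries.mk fun m => (catalan m : ℤ) := by
  have hC := mk_catalan_eq_one_add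
  have hT : PowerSeries.mk C1 =
      X * (2 * ((PowerSeries.mk fun m => (catalan m : ℤ)) * PowerSeries.mk C1) +
      (PowerSeries.mk fun m => (catalan m : ℤ)) *
        PowerSeries.mk fun k => (k : ℤ) * ((k : ℤ) + 1) * (catalan k : ℤ)) := by
    ext n
    cases n with
    | zero => simp [h0]
    | succ m =>
      rw [coeff_succ_X_mul, coeff_mk, hrec, two_mul (_ * _), map_add, map_add, ← two_mul,
        mul_comm _ (PowerSeries.mk C1),
        mul_comm _ (PowerSeries.mk fun k => (k : ℤ) * ((k : ℤ) + 1) * (catalan k : ℤ))]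
      simp only [coeff_mul, coeff_mk, Finset.Nat.sum_antidiagonal_eq_sum_range_succ_mk]
      congr 1
      · congr 1
        exact Finset.sum_congr rfl fun k _ => mul_comm _ _
      · exact Finset.sum_congr rfl fun k _ => by ring
  rw [mk_mul_succ_eq_X_mul_derivative] at hT
  generalize (PowerSeries.mk fun m => (catalan m : ℤ)) = c at *
  have h3 := cube_mul_derivative_derivative (F := X * c) (by linear_combination X * hC)
  have hs : 1 - 4 * X = (1 - 2 * (X * c)) ^ 2 := by linear_combination 4 * X * hC
  rw [hs]
  linear_combination (1 - 2 * (X * c)) ^ 3 * hT + X ^ 2 * c * h3
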